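/- Let T be a tetrahedron of volume 1, c the centroid of one of its facets, and X_1, X_2, X_3 iid uniform random points in T. Then E[vol(conv{X_1,X_2,X_3,c})] < 13/720 - π²/15015. -/

import Mathlib

open MeasureTheory

theorem integral_pow_mul_sub_pow (s : ℝ) (m n : ℕ) :
    ∫ x in (0 : ℝ)..s, x ^ m * (s - x) ^ n =
      (m.factorial * n.factorial : ℝ) / (m + n + 1).factorial * s ^ (m + n + 1) := by
  induction n generalizing m with
  | zero =>
    simp only [pow_zero, mul_one, add_zero, integral_pow, Nat.factorial_zero, Nat.cast_one,
      Nat.factorial_succ m]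
    have := Nat.factorial_ne_zero m
    push_cast
    field_simp
    ring
  | succ n ih =>
    have hparts : ∫ x in (0 : ℝ)..s,
        ((m + 1 : ℝ) * (x ^ m * (s - x) ^ (n + 1)) - (n + 1) * (x ^ (m + 1) * (s - x) ^ n)) = 0 := by
      rw [intervalIntegral.integral_eq_sub_of_hasDerivAt
        (f := fun x ↦ x ^ (m + 1) * (s - x) ^ (n + 1))]
      · simp
      · intro x _
        refine ((hasDerivAt_pow (m + 1) x).mul
          (((hasDerivAt_id x).const_sub s).pow (n + 1))).congr_deriv ?_
        simp only [Pi.pow_apply, id, Nat.add_sub_cancel]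
        push_cast
        ring
      · exact Continuous.intervalIntegrable (by fun_prop) _ _
    rw [intervalIntegral.integral_sub (Continuous.intervalIntegrable (by fun_prop) _ _)
      (Continuous.intervalIntegrable (by fun_prop) _ _), intervalIntegral.integral_const_mul,
      intervalIntegral.integral_const_mul, ih] at hparts
    have hm : (m + 1 : ℝ) ≠ 0 := by positivity
    apply mul_left_cancel₀ hm
    rw [sub_eq_zero.1 hparts, show m + 1 + n + 1 = m + (n + 1) + 1 by ring, Nat.factorial_succ m,
      Nat.factorial_succ n]
    push_cast
    ring

/-- The corner simplex of side `s` in dimension `n`. -/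
def cornerSimplex (n : ℕ) (s : ℝ) : Set (Fin n → ℝ) := {x | (∀ i, 0 ≤ x i) ∧ ∑ i, x i ≤ s}

theorem isCompact_cornerSimplex (n : ℕ) (s : ℝ) : IsCompact (cornerSimplex n s) := by
  have hclosed : IsClosed (cornerSimplex n s) := by
    have : cornerSimplex n s = (⋂ i, {x | 0 ≤ x i}) ∩ {x | ∑ i, x i ≤ s} := by
      ext x; simp [cornerSimplex]
    rw [this]
    exact (isClosed_iInter fun i ↦ isClosed_le (by fun_prop) (by fun_prop)).inter
      (isClosed_le (by fun_prop) (by fun_prop))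
  refine (isCompact_Icc (a := (0 : Fin n → ℝ)) (b := fun _ ↦ s)).of_isClosed_subset hclosed ?_
  intro x hx
  exact ⟨hx.1, fun i ↦
    (Finset.single_le_sum (fun j _ ↦ hx.1 j) (Finset.mem_univ i)).trans hx.2⟩

theorem cons_mem_cornerSimplex {n : ℕ} {s t : ℝ} {y : Fin n → ℝ} :
    (Fin.cons t y : Fin (n + 1) → ℝ) ∈ cornerSimplex (n + 1) s ↔
      0 ≤ t ∧ y ∈ cornerSimplex n (s - t) := by
  simp only [cornerSimplex, Set.mem_ofPred_eq, Fin.forall_fin_succ, Fin.cons_zero, Fin.cons_succ,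
    Fin.sum_univ_succ, and_assoc, le_sub_iff_add_le']

theorem setIntegral_cornerSimplex_succ {n : ℕ} {s : ℝ} (hs : 0 ≤ s) {f : (Fin (n + 1) → ℝ) → ℝ}
    (hf : Continuous f) :
    ∫ x in cornerSimplex (n + 1) s, f x =
      ∫ t in (0 : ℝ)..s, ∫ y in cornerSimplex n (s - t), f (Fin.cons t y) := by
  have hmeas := (isCompact_cornerSimplex (n + 1) s).measurableSet
  have hint : Integrable ((cornerSimplex (n + 1) s).indicator f) :=
    (integrable_indicator_iff hmeas).2
      (hf.continuousOn.integrableOn_compact (isCompact_cornerSimplex _ _))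
  have hmp := (volume_preserving_piFinSuccAbove (fun _ : Fin (n + 1) ↦ ℝ) 0).symm
  have hcons (p : ℝ × (Fin n → ℝ)) :
      (MeasurableEquiv.piFinSuccAbove (fun _ : Fin (n + 1) ↦ ℝ) 0).symm p = Fin.cons p.1 p.2 := by
    simp [MeasurableEquiv.piFinSuccAbove, Fin.insertNthEquiv]
  rw [← integral_indicator hmeas, ← hmp.integral_comp']
  have hint' := (hmp.integrable_comp_emb (MeasurableEquiv.measurableEmbedding _)).2 hint
  have := integral_prod _ hint'
  simp only [Function.comp_def] at this
  rw [← Measure.volume_eq_prod] at this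
  rw [this]
  rw [intervalIntegral.integral_of_le hs, ← integral_Icc_eq_integral_Ioc,
    ← integral_indicator measurableSet_Icc]
  refine integral_congr_ae (Filter.Eventually.of_forall fun t ↦ ?_)
  simp only [hcons]
  by_cases ht : t ∈ Set.Icc 0 s
  · rw [Set.indicator_of_mem ht, ← integral_indicator (isCompact_cornerSimplex _ _).measurableSet]
    refine integral_congr_ae (Filter.Eventually.of_forall fun y ↦ ?_)
    by_cases hy : y ∈ cornerSimplex n (s - t)
    · exact (Set.indicator_of_mem (cons_mem_cornerSimplex.2 ⟨ht.1, hy⟩) f).trans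
        (Set.indicator_of_mem hy fun y ↦ f (Fin.cons t y)).symm
    · exact (Set.indicator_of_notMem (fun h ↦ hy (cons_mem_cornerSimplex.1 h).2) f).trans
        (Set.indicator_of_notMem hy _).symm
  · rw [Set.indicator_of_notMem ht]
    refine integral_eq_zero_of_ae (Filter.Eventually.of_forall fun y ↦ ?_)
    refine Set.indicator_of_notMem (fun h ↦ ht ?_) _
    rw [cons_mem_cornerSimplex] at h
    exact ⟨h.1, sub_nonneg.1 ((Finset.sum_nonneg fun i _ ↦ h.2.1 i).trans h.2.2)⟩

/-- Dirichlet's integral over the corner simplex, for natural exponents. -/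
theorem setIntegral_cornerSimplex_prod_pow (n d : ℕ) (a : Fin n → ℕ) {s : ℝ} (hs : 0 ≤ s) :
    ∫ x in cornerSimplex n s, (∏ i, x i ^ a i) * (s - ∑ i, x i) ^ d =
      ((∏ i, ((a i).factorial : ℝ)) * d.factorial) / (∑ i, a i + d + n).factorial *
        s ^ (∑ i, a i + d + n) := by
  induction n generalizing s with
  | zero =>
    have : cornerSimplex 0 s = Set.univ := by ext; simp [cornerSimplex, hs]
    have := Nat.factorial_ne_zero d
    simp [*, Measure.real, volume_pi]
  | succ n ih =>
    rw [setIntegral_cornerSimplex_succ hs (by fun_prop)]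
    have key : ∀ t ∈ Set.uIcc 0 s, (∫ y in cornerSimplex n (s - t),
        (∏ i, (Fin.cons t y : Fin (n + 1) → ℝ) i ^ a i) *
          (s - ∑ i, (Fin.cons t y : Fin (n + 1) → ℝ) i) ^ d) =
        ((∏ i : Fin n, ((a i.succ).factorial : ℝ)) * d.factorial) /
          (∑ i : Fin n, a i.succ + d + n).factorial *
          (t ^ a 0 * (s - t) ^ (∑ i : Fin n, a i.succ + d + n)) := by
      intro t ht
      rw [Set.uIcc_of_le hs] at ht
      simp only [Fin.prod_univ_succ, Fin.sum_univ_succ, Fin.cons_zero, Fin.cons_succ, mul_assoc,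
        ← sub_sub]
      rw [integral_const_mul, ih _ (sub_nonneg.2 ht.2)]
      ring
    rw [intervalIntegral.integral_congr key, intervalIntegral.integral_const_mul,
      integral_pow_mul_sub_pow, Fin.prod_univ_succ, Fin.sum_univ_succ,
      show a 0 + (∑ i : Fin n, a i.succ + d + n) + 1 =
        a 0 + ∑ i : Fin n, a i.succ + d + (n + 1) by ring]
    have := Nat.factorial_ne_zero (∑ i : Fin n, a i.succ + d + n)
    field_simp

theorem convex_cornerSimplex (n : ℕ) (s : ℝ) : Convex ℝ (cornerSimplex n s) := by
  have : cornerSimplex n s = (⋂ i, {x | 0 ≤ x i}) ∩ {x | ∑ i, x i ≤ s} := by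
    ext x; simp [cornerSimplex]
  rw [this]
  refine (convex_iInter fun i ↦ convex_halfSpace_ge (f := fun x : Fin n → ℝ ↦ x i) ?_ 0).inter
    (convex_halfSpace_le (f := fun x : Fin n → ℝ ↦ ∑ i, x i) ?_ s)
  · exact (LinearMap.proj (R := ℝ) (φ := fun _ : Fin n ↦ ℝ) i).isLinear
  · exact ⟨fun x y ↦ by simp [Finset.sum_add_distrib], fun c x ↦ by simp [Finset.mul_sum]⟩

theorem measureReal_cornerSimplex_one (n : ℕ) :
    volume.real (cornerSimplex n 1) = 1 / n.factorial := by
  simpa using setIntegral_cornerSimplex_prod_pow n 0 (fun _ ↦ 0) zero_le_one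

/-- The matrix whose columns are the edges from the last vertex to the other vertices. -/
def edgeMatrix {n : ℕ} (v : Fin (n + 1) → Fin n → ℝ) : Matrix (Fin n) (Fin n) ℝ :=
  Matrix.of fun i j ↦ v j.castSucc i - v (Fin.last n) i

theorem image_cornerSimplex {n : ℕ} (v : Fin (n + 1) → Fin n → ℝ) :
    (fun x ↦ v (Fin.last n) + (edgeMatrix v).mulVec x) '' cornerSimplex n 1 =
      convexHull ℝ (Set.range v) := by
  apply Set.Subset.antisymm
  · rintro _ ⟨x, hx, rfl⟩
    refine mem_convexHull_of_exists_fintype (Fin.snoc x (1 - ∑ i, x i) : Fin (n + 1) → ℝ) v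
      (fun i ↦ ?_) ?_ (fun i ↦ Set.mem_range_self i) ?_
    · refine Fin.lastCases ?_ (fun j ↦ ?_) i
      · simpa using hx.2
      · simpa using hx.1 j
    · simp [Fin.sum_univ_castSucc]
    · ext i
      simp only [Fin.sum_univ_castSucc, Fin.snoc_castSucc, Fin.snoc_last, Pi.add_apply,
        Finset.sum_apply, Pi.smul_apply, smul_eq_mul, Matrix.mulVec, dotProduct, edgeMatrix,
        Matrix.of_apply, sub_mul, Finset.sum_sub_distrib, one_mul, Finset.sum_mul]
      simp only [mul_comm]
      ring
  · refine convexHull_min ?_ ?_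
    · rintro _ ⟨i, rfl⟩
      refine Fin.lastCases ?_ (fun j ↦ ?_) i
      · exact ⟨0, by simp [cornerSimplex], by simp⟩
      · refine ⟨Pi.single j 1, ⟨fun i ↦ ?_, by simp⟩, ?_⟩
        · by_cases h : i = j <;> simp [h]
        · ext i
          simp [edgeMatrix, Matrix.col_apply]
    · have := ((convex_cornerSimplex n 1).linear_image (Matrix.mulVecLin (edgeMatrix v))).translate
        (v (Fin.last n))
      rwa [Set.image_image] at this

theorem measureReal_image_affine {n : ℕ} (b : Fin n → ℝ) (M : Matrix (Fin n) (Fin n) ℝ)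
    (s : Set (Fin n → ℝ)) :
    volume.real ((fun x ↦ b + M.mulVec x) '' s) = |M.det| * volume.real s := by
  have : (fun x ↦ b + M.mulVec x) '' s = (b + ·) '' (Matrix.toLin' M '' s) := by
    rw [Set.image_image]; rfl
  rw [this, Measure.real, Set.image_add_left, measure_preimage_add, Measure.addHaar_image_linearMap,
    LinearMap.det_toLin', ENNReal.toReal_mul, ENNReal.toReal_ofReal (abs_nonneg _), Measure.real]

theorem measureReal_convexHull_range {n : ℕ} (v : Fin (n + 1) → Fin n → ℝ) :
    volume.real (convexHull ℝ (Set.range v)) = |(edgeMatrix v).det| / n.factorial := by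
  rw [← image_cornerSimplex, measureReal_image_affine, measureReal_cornerSimplex_one,
    mul_one_div]

theorem setIntegral_image_affine {n : ℕ} (b : Fin n → ℝ) {M : Matrix (Fin n) (Fin n) ℝ}
    (hM : M.det ≠ 0) {s : Set (Fin n → ℝ)} (hs : MeasurableSet s) (f : (Fin n → ℝ) → ℝ) :
    ∫ x in (fun x ↦ b + M.mulVec x) '' s, f x = |M.det| * ∫ x in s, f (b + M.mulVec x) := by
  have hinj : Function.Injective (fun x ↦ b + M.mulVec x) := fun x y h ↦
    Matrix.mulVec_injective_of_isUnit ((Matrix.isUnit_iff_isUnit_det M).2 hM.isUnit)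
      (add_left_cancel h)
  have hderiv : ∀ x ∈ s, HasFDerivWithinAt (fun x ↦ b + M.mulVec x)
      (LinearMap.toContinuousLinearMap (Matrix.toLin' M)) s x := fun x _ ↦
    ((LinearMap.toContinuousLinearMap (Matrix.toLin' M)).hasFDerivWithinAt).const_add b
  rw [integral_image_eq_integral_abs_det_fderiv_smul volume hs hderiv hinj.injOn]
  simp only [smul_eq_mul, integral_const_mul]
  simp [ContinuousLinearMap.det, LinearMap.det_toLin']

section TripleIntegral

variable {E : Type*} [TopologicalSpace E] [MeasurableSpace E]

/-- `f` is continuous and its iterated integral against three copies of `μ` is `c`. -/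
def HasTripleIntegral (μ : Measure E) (f : E → E → E → ℝ) (c : ℝ) : Prop :=
  Continuous (fun p : E × E × E ↦ f p.1 p.2.1 p.2.2) ∧
    ∫ x, ∫ y, ∫ z, f x y z ∂μ ∂μ ∂μ = c

theorem HasTripleIntegral.const_mul {μ : Measure E} {f : E → E → E → ℝ} {c : ℝ}
    (h : HasTripleIntegral μ f c) (r : ℝ) :
    HasTripleIntegral μ (fun x y z ↦ r * f x y z) (r * c) :=
  ⟨h.1.const_mul r, by simp only [integral_const_mul, h.2]⟩

theorem hasTripleIntegral_mul_mul (μ : Measure E) {f g h : E → ℝ} (hf : Continuous f)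
    (hg : Continuous g) (hh : Continuous h) :
    HasTripleIntegral μ (fun x y z ↦ f x * (g y * h z))
      ((∫ x, f x ∂μ) * ((∫ x, g x ∂μ) * ∫ x, h x ∂μ)) :=
  ⟨by fun_prop, by simp only [integral_const_mul, integral_mul_const]⟩

variable [OpensMeasurableSpace E] {K : Set E} {μ : Measure E} [IsFiniteMeasure μ]

theorem Continuous.integrable_of_restrict_eq [T2Space E] (hK : IsCompact K) (hμ : μ.restrict K = μ)
    {f : E → ℝ} (hf : Continuous f) : Integrable f μ := by
  have := hf.continuousOn.integrableOn_compact (μ := μ) hK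
  rwa [IntegrableOn, hμ] at this

theorem Continuous.integral_of_restrict_eq (hK : IsCompact K) (hμ : μ.restrict K = μ)
    {X : Type*} [TopologicalSpace X] [FirstCountableTopology X] [LocallyCompactSpace X]
    {f : X → E → ℝ} (hf : Continuous f.uncurry) : Continuous fun x ↦ ∫ y, f x y ∂μ := by
  have := continuous_parametric_integral_of_continuous (μ := μ) hf hK
  rwa [hμ] at this

variable [FirstCountableTopology E] [LocallyCompactSpace E] [T2Space E]

theorem Continuous.integral_integral_of_restrict_eq (hK : IsCompact K) (hμ : μ.restrict K = μ)
    {f : E → E → E → ℝ} (hf : Continuous (fun p : E × E × E ↦ f p.1 p.2.1 p.2.2)) :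
    (∀ x y, Integrable (f x y) μ) ∧
    (∀ x, Integrable (fun y ↦ ∫ z, f x y z ∂μ) μ) ∧
    Integrable (fun x ↦ ∫ y, ∫ z, f x y z ∂μ ∂μ) μ := by
  have hz : Continuous fun p : E × E ↦ ∫ z, f p.1 p.2 z ∂μ := by
    refine Continuous.integral_of_restrict_eq hK hμ (f := fun (p : E × E) z ↦ f p.1 p.2 z) ?_
    exact hf.comp (f := fun q : (E × E) × E ↦ (q.1.1, q.1.2, q.2)) (by fun_prop)
  refine ⟨fun x y ↦ Continuous.integrable_of_restrict_eq hK hμ ?_,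
    fun x ↦ Continuous.integrable_of_restrict_eq hK hμ ?_,
    Continuous.integrable_of_restrict_eq hK hμ ?_⟩
  · exact hf.comp (f := fun z : E ↦ (x, y, z)) (by fun_prop)
  · exact hz.comp (f := fun y : E ↦ (x, y)) (by fun_prop)
  · exact Continuous.integral_of_restrict_eq hK hμ (f := fun x y ↦ ∫ z, f x y z ∂μ) hz

theorem HasTripleIntegral.sum (hK : IsCompact K) (hμ : μ.restrict K = μ) {ι : Type*}
    {s : Finset ι} {f : ι → E → E → E → ℝ} {c : ι → ℝ}
    (h : ∀ i ∈ s, HasTripleIntegral μ (f i) (c i)) :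
    HasTripleIntegral μ (fun x y z ↦ ∑ i ∈ s, f i x y z) (∑ i ∈ s, c i) := by
  have hi := fun i (his : i ∈ s) ↦ Continuous.integral_integral_of_restrict_eq hK hμ (h i his).1
  refine ⟨continuous_finsetSum _ fun i his ↦ (h i his).1, ?_⟩
  have hz (x y : E) : ∫ z, ∑ i ∈ s, f i x y z ∂μ = ∑ i ∈ s, ∫ z, f i x y z ∂μ :=
    integral_finsetSum _ fun i his ↦ (hi i his).1 x y
  have hy (x : E) : ∫ y, ∑ i ∈ s, ∫ z, f i x y z ∂μ ∂μ = ∑ i ∈ s, ∫ y, ∫ z, f i x y z ∂μ ∂μ :=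
    integral_finsetSum _ fun i his ↦ (hi i his).2.1 x
  simp only [hz, hy]
  rw [integral_finsetSum _ fun i his ↦ (hi i his).2.2]
  exact Finset.sum_congr rfl fun i his ↦ (h i his).2

theorem HasTripleIntegral.mono (hK : IsCompact K) (hμ : μ.restrict K = μ)
    {f g : E → E → E → ℝ} {c d : ℝ} (hf : HasTripleIntegral μ f c) (hg : HasTripleIntegral μ g d)
    (hfg : ∀ x y z, f x y z ≤ g x y z) : c ≤ d := by
  have hif := Continuous.integral_integral_of_restrict_eq hK hμ hf.1
  have hig := Continuous.integral_integral_of_restrict_eq hK hμ hg.1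
  rw [← hf.2, ← hg.2]
  exact integral_mono hif.2.2 hig.2.2 fun x ↦ integral_mono (hif.2.1 x) (hig.2.1 x) fun y ↦
    integral_mono (hif.1 x y) (hig.1 x y) (hfg x y)

end TripleIntegral

section Shell

open scoped Pointwise

variable {E : Type*} [NormedAddCommGroup E] [NormedSpace ℝ E] [FiniteDimensional ℝ E]
  [MeasureSpace E] [BorelSpace E] [(volume : Measure E).IsAddHaarMeasure] {K : Set E} {q : ℝ}
  {n : ℕ}

theorem setIntegral_diff_smul (hK : IsCompact K) (hq : 0 < q) (hqK : q • K ⊆ K) {f : E → ℝ}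
    (hf : Continuous f) (hn : ∀ x, f (q • x) = q ^ n * f x) :
    ∫ x in K \ (q • K), f x = (1 - q ^ (n + Module.finrank ℝ E)) * ∫ x in K, f x := by
  rw [setIntegral_sdiff (hK.smul q).measurableSet (hf.continuousOn.integrableOn_compact hK) hqK]
  have h := Measure.setIntegral_comp_smul_of_pos (volume : Measure E) f K hq
  simp only [hn, integral_const_mul, smul_eq_mul] at h
  have hpos : q ^ Module.finrank ℝ E ≠ 0 := (pow_pos hq _).ne'
  rw [eq_inv_mul_iff_mul_eq₀ hpos] at h
  rw [← h]
  ring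

theorem HasTripleIntegral.diff_smul (hK : IsCompact K) (hq : 0 < q) (hqK : q • K ⊆ K)
    {f : E → E → E → ℝ} {c : ℝ} (hf : HasTripleIntegral (volume.restrict K) f c)
    (h₁ : ∀ x y z, f (q • x) y z = q ^ n * f x y z)
    (h₂ : ∀ x y z, f x (q • y) z = q ^ n * f x y z)
    (h₃ : ∀ x y z, f x y (q • z) = q ^ n * f x y z) :
    HasTripleIntegral (volume.restrict (K \ (q • K))) f
      ((1 - q ^ (n + Module.finrank ℝ E)) ^ 3 * c) := by
  refine ⟨hf.1, ?_⟩
  have hz : Continuous fun p : E × E ↦ ∫ z in K, f p.1 p.2 z :=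
    continuous_parametric_integral_of_continuous (f := fun (p : E × E) z ↦ f p.1 p.2 z)
      (hf.1.comp (f := fun r : (E × E) × E ↦ (r.1.1, r.1.2, r.2)) (by fun_prop)) hK
  have hy : Continuous fun x ↦ ∫ y in K, ∫ z in K, f x y z :=
    continuous_parametric_integral_of_continuous (f := fun x y ↦ ∫ z in K, f x y z) hz hK
  have ez (x y : E) : ∫ z in K \ (q • K), f x y z =
      (1 - q ^ (n + Module.finrank ℝ E)) * ∫ z in K, f x y z :=
    setIntegral_diff_smul hK hq hqK (hf.1.comp (f := fun z : E ↦ (x, y, z)) (by fun_prop)) (h₃ x y)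
  have ey (x : E) : ∫ y in K \ (q • K), ∫ z in K, f x y z =
      (1 - q ^ (n + Module.finrank ℝ E)) * ∫ y in K, ∫ z in K, f x y z :=
    setIntegral_diff_smul hK hq hqK (hz.comp (f := fun y : E ↦ (x, y)) (by fun_prop))
      fun y ↦ by simp only [h₂, integral_const_mul]
  have ex : ∫ x in K \ (q • K), ∫ y in K, ∫ z in K, f x y z =
      (1 - q ^ (n + Module.finrank ℝ E)) * ∫ x in K, ∫ y in K, ∫ z in K, f x y z :=
    setIntegral_diff_smul hK hq hqK hy fun x ↦ by simp only [h₁, integral_const_mul]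
  simp only [ez, ey, integral_const_mul, ex, hf.2]
  ring

end Shell

section Moments

open Finset Nat

/-- The vertices of a tetrahedron whose facet opposite the last vertex has centroid `0`. -/
def centeredVertex : Fin 4 → Fin 3 → ℝ := ![![1, 0, 0], ![0, 1, 0], ![-1, -1, 0], ![0, 0, 1]]

/-- The tetrahedron spanned by `centeredVertex`. -/
def centeredTetrahedron : Set (Fin 3 → ℝ) := convexHull ℝ (Set.range centeredVertex)

theorem isCompact_centeredTetrahedron : IsCompact centeredTetrahedron :=
  (Set.finite_range _).isCompact_convexHull (𝕜 := ℝ)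

theorem zero_mem_centeredTetrahedron : (0 : Fin 3 → ℝ) ∈ centeredTetrahedron := by
  refine mem_convexHull_of_exists_fintype (fun i ↦ ![1 / 3, 1 / 3, 1 / 3, 0] i) centeredVertex
    (fun i ↦ ?_) ?_ (fun i ↦ Set.mem_range_self i) ?_
  · fin_cases i <;> norm_num
  · norm_num [Fin.sum_univ_succ]
  · ext i
    fin_cases i <;> norm_num [Fin.sum_univ_succ, centeredVertex]

theorem abs_det_edgeMatrix_centeredVertex : |(edgeMatrix centeredVertex).det| = 3 := by
  rw [Matrix.det_fin_three]
  simp [edgeMatrix, centeredVertex, Fin.last]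
  norm_num

theorem measureReal_centeredTetrahedron : volume.real centeredTetrahedron = 1 / 2 := by
  rw [centeredTetrahedron, measureReal_convexHull_range, abs_det_edgeMatrix_centeredVertex]
  norm_num [Nat.factorial]

/-- Up to the factor `3 * k! / (i + j + k + 3)!`, the integral of `x₀ ^ i * x₁ ^ j * x₂ ^ k` over
`centeredTetrahedron`. -/
def facetMoment (i j : ℕ) : ℤ :=
  ∑ a ∈ range (i + 1), ∑ b ∈ range (j + 1),
    (-1) ^ (i - a + (j - b)) * (i.choose a * j.choose b) * (a ! * (b ! * (i - a + (j - b))!))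

theorem setIntegral_centeredTetrahedron_pow (i j k : ℕ) :
    ∫ x in centeredTetrahedron, x 0 ^ i * x 1 ^ j * x 2 ^ k =
      3 * (facetMoment i j * k !) / (i + j + k + 3)! := by
  have hdet : (edgeMatrix centeredVertex).det ≠ 0 := by
    rw [← abs_pos, abs_det_edgeMatrix_centeredVertex]; norm_num
  have hexp (x : Fin 3 → ℝ) :
      (x 0 - x 2) ^ i * (x 1 - x 2) ^ j * (1 - ∑ l, x l) ^ k =
        ∑ a ∈ range (i + 1), ∑ b ∈ range (j + 1),
          ((-1) ^ (i - a + (j - b)) * (i.choose a * j.choose b)) *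
            ((∏ l, x l ^ (![a, b, i - a + (j - b)] l)) * (1 - ∑ l, x l) ^ k) := by
    rw [sub_eq_add_neg, sub_eq_add_neg (x 1), add_pow, add_pow, sum_mul_sum, sum_mul]
    refine sum_congr rfl fun a _ ↦ ?_
    rw [sum_mul]
    refine sum_congr rfl fun b _ ↦ ?_
    rw [neg_pow (x 2), neg_pow (x 2), Fin.prod_univ_three]
    simp only [Matrix.cons_val]
    ring
  rw [centeredTetrahedron, ← image_cornerSimplex, setIntegral_image_affine _ hdet
    (isCompact_cornerSimplex 3 1).measurableSet, abs_det_edgeMatrix_centeredVertex]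
  have hcoord (x : Fin 3 → ℝ) :
      (centeredVertex (Fin.last 3) + (edgeMatrix centeredVertex).mulVec x) 0 = x 0 - x 2 ∧
      (centeredVertex (Fin.last 3) + (edgeMatrix centeredVertex).mulVec x) 1 = x 1 - x 2 ∧
      (centeredVertex (Fin.last 3) + (edgeMatrix centeredVertex).mulVec x) 2 = 1 - ∑ l, x l := by
    simp [Matrix.mulVec, dotProduct, edgeMatrix, centeredVertex, Fin.sum_univ_three, Fin.last]
    refine ⟨?_, ?_, ?_⟩ <;> ring
  have hint (g : (Fin 3 → ℝ) → ℝ) (hg : Continuous g) :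
      Integrable g (volume.restrict (cornerSimplex 3 1)) :=
    hg.continuousOn.integrableOn_compact (isCompact_cornerSimplex 3 1)
  simp only [(hcoord _).1, (hcoord _).2.1, (hcoord _).2.2, hexp]
  rw [integral_finsetSum _ fun a _ ↦ hint _ (by fun_prop), mul_div_assoc, facetMoment]
  push_cast
  rw [sum_mul, sum_div]
  congr 1
  refine sum_congr rfl fun a ha ↦ ?_
  rw [integral_finsetSum _ fun a _ ↦ hint _ (by fun_prop), sum_mul, sum_div]
  refine sum_congr rfl fun b hb ↦ ?_
  rw [integral_const_mul, setIntegral_cornerSimplex_prod_pow _ _ _ zero_le_one]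
  have ha := mem_range_succ_iff.1 ha
  have hb := mem_range_succ_iff.1 hb
  simp only [Fin.sum_univ_three, Fin.prod_univ_three, Matrix.cons_val, one_pow]
  rw [show a + b + (i - a + (j - b)) + k + 3 = i + j + k + 3 by omega]
  ring

/-- The determinant of three vectors. -/
def det₃ (x y z : Fin 3 → ℝ) : ℝ :=
  x 0 * (y 1 * z 2 - y 2 * z 1) + x 1 * (y 2 * z 0 - y 0 * z 2) + x 2 * (y 0 * z 1 - y 1 * z 0)

/-- The combination of products of coordinate moments which gives the `n`-th moment of `det₃`, where
the coordinate moment with exponents `i`, `j`, `k` is `g i j * k!`. -/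
def detMomentSum (g : ℕ → ℕ → ℤ) (n : ℕ) : ℤ :=
  ∑ i ∈ range (n + 1), ∑ j ∈ range (n - i + 1), n.choose i * (n - i).choose j *
    ∑ a ∈ range (i + 1), ∑ b ∈ range (j + 1), ∑ c ∈ range (n - i - j + 1),
      (-1) ^ (i - a + (j - b) + (n - i - j - c)) *
        (i.choose a * j.choose b * (n - i - j).choose c) *
        ((g i j * (n - i - j)!) *
          ((g (j - b + c) (a + (n - i - j - c)) * (i - a + b)!) *
            (g (b + (n - i - j - c)) (i - a + c) * (a + (j - b))!)))

theorem hasTripleIntegral_monomial {n : ℕ} (i j k i₂ j₂ k₂ i₃ j₃ k₃ : ℕ)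
    (h : i + j + k = n) (h₂ : i₂ + j₂ + k₂ = n) (h₃ : i₃ + j₃ + k₃ = n) :
    HasTripleIntegral (volume.restrict centeredTetrahedron)
      (fun x y z ↦ (x 0 ^ i * x 1 ^ j * x 2 ^ k) *
        ((y 0 ^ i₂ * y 1 ^ j₂ * y 2 ^ k₂) * (z 0 ^ i₃ * z 1 ^ j₃ * z 2 ^ k₃)))
      (27 / ((n + 3)! : ℝ) ^ 3 * ((facetMoment i j * k !) *
        ((facetMoment i₂ j₂ * k₂ !) * (facetMoment i₃ j₃ * k₃ !)))) := by
  have H := hasTripleIntegral_mul_mul (volume.restrict centeredTetrahedron)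
    (f := fun x : Fin 3 → ℝ ↦ x 0 ^ i * x 1 ^ j * x 2 ^ k)
    (g := fun x : Fin 3 → ℝ ↦ x 0 ^ i₂ * x 1 ^ j₂ * x 2 ^ k₂)
    (h := fun x : Fin 3 → ℝ ↦ x 0 ^ i₃ * x 1 ^ j₃ * x 2 ^ k₃)
    (by fun_prop) (by fun_prop) (by fun_prop)
  rw [setIntegral_centeredTetrahedron_pow, setIntegral_centeredTetrahedron_pow,
    setIntegral_centeredTetrahedron_pow, h, h₂, h₃] at H
  convert H using 1
  ring

theorem det₃_pow (x y z : Fin 3 → ℝ) (n : ℕ) :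
    det₃ x y z ^ n =
      ∑ i ∈ range (n + 1), ∑ j ∈ range (n - i + 1), (n.choose i * (n - i).choose j : ℝ) *
        ∑ a ∈ range (i + 1), ∑ b ∈ range (j + 1), ∑ c ∈ range (n - i - j + 1),
          ((-1) ^ (i - a + (j - b) + (n - i - j - c)) *
            (i.choose a * j.choose b * (n - i - j).choose c) : ℝ) *
          ((x 0 ^ i * x 1 ^ j * x 2 ^ (n - i - j)) *
            ((y 0 ^ (j - b + c) * y 1 ^ (a + (n - i - j - c)) * y 2 ^ (i - a + b)) *
              (z 0 ^ (b + (n - i - j - c)) * z 1 ^ (i - a + c) * z 2 ^ (a + (j - b))))) := by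
  rw [det₃, add_assoc, add_pow]
  refine sum_congr rfl fun i _ ↦ ?_
  rw [add_pow, mul_sum, sum_mul]
  refine sum_congr rfl fun j _ ↦ ?_
  have expand (u v : ℝ) (m : ℕ) : (u - v) ^ m =
      ∑ a ∈ range (m + 1), u ^ a * ((-1) ^ (m - a) * v ^ (m - a)) * m.choose a := by
    rw [sub_eq_add_neg, add_pow]
    exact sum_congr rfl fun a _ ↦ by rw [neg_pow v]
  rw [mul_pow (x 0), mul_pow (x 1), mul_pow (x 2), expand (y 1 * z 2), expand (y 2 * z 0),
    expand (y 0 * z 1)]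
  generalize n - i - j = k
  calc _ = ((n.choose i * (n - i).choose j : ℝ) * (x 0 ^ i * x 1 ^ j * x 2 ^ k)) *
        ((∑ a ∈ range (i + 1), (y 1 * z 2) ^ a * ((-1) ^ (i - a) * (y 2 * z 1) ^ (i - a)) *
            (i.choose a : ℝ)) *
          ((∑ b ∈ range (j + 1), (y 2 * z 0) ^ b * ((-1) ^ (j - b) * (y 0 * z 2) ^ (j - b)) *
            (j.choose b : ℝ)) *
          ∑ c ∈ range (k + 1), (y 0 * z 1) ^ c * ((-1) ^ (k - c) * (y 1 * z 0) ^ (k - c)) *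
            (k.choose c : ℝ))) := by ring
    _ = _ := by
      rw [mul_assoc, sum_mul]
      congr 1
      rw [mul_sum]
      refine sum_congr rfl fun a _ ↦ ?_
      rw [sum_mul_sum, mul_sum, mul_sum]
      refine sum_congr rfl fun b _ ↦ ?_
      rw [mul_sum, mul_sum]
      refine sum_congr rfl fun c _ ↦ ?_
      ring

theorem hasTripleIntegral_det₃_pow (n : ℕ) :
    HasTripleIntegral (volume.restrict centeredTetrahedron) (fun x y z ↦ det₃ x y z ^ n)
      (27 / ((n + 3)! : ℝ) ^ 3 * detMomentSum facetMoment n) := by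
  have : IsFiniteMeasure (volume.restrict centeredTetrahedron) :=
    ⟨by simpa using isCompact_centeredTetrahedron.measure_lt_top⟩
  have hK := isCompact_centeredTetrahedron
  have hμ : (volume.restrict centeredTetrahedron).restrict centeredTetrahedron =
      volume.restrict centeredTetrahedron := by
    rw [Measure.restrict_restrict hK.measurableSet, Set.inter_self]
  simp only [det₃_pow]
  have H := HasTripleIntegral.sum hK hμ (s := range (n + 1)) fun i hi ↦
    HasTripleIntegral.sum hK hμ (s := range (n - i + 1)) fun j hj ↦
      (HasTripleIntegral.sum hK hμ (s := range (i + 1)) fun a ha ↦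
        HasTripleIntegral.sum hK hμ (s := range (j + 1)) fun b hb ↦
        HasTripleIntegral.sum hK hμ (s := range (n - i - j + 1)) fun c hc ↦
          (hasTripleIntegral_monomial (n := n) i j (n - i - j)
            (j - b + c) (a + (n - i - j - c)) (i - a + b)
            (b + (n - i - j - c)) (i - a + c) (a + (j - b))
            (by simp only [mem_range] at *; omega) (by simp only [mem_range] at *; omega)
            (by simp only [mem_range] at *; omega)).const_mul
            ((-1) ^ (i - a + (j - b) + (n - i - j - c)) *
            (i.choose a * j.choose b * (n - i - j).choose c) : ℝ)).const_mul
              (n.choose i * (n - i).choose j : ℝ)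
  convert H using 1
  rw [detMomentSum]
  push_cast
  simp only [mul_sum]
  refine sum_congr rfl fun i _ ↦ sum_congr rfl fun j _ ↦ sum_congr rfl fun a _ ↦
    sum_congr rfl fun b _ ↦ sum_congr rfl fun c _ ↦ ?_
  ring

end Moments

section Evaluation

open Finset Nat

/-- The values of `facetMoment i j` for `i + j ≤ 10`. -/
def facetMomentTable : List (List ℤ) :=
  [[1, 0, 2, 0, 24, 0, 720, 0, 40320, 0, 3628800],
    [0, 1, -2, 12, -48, 360, -2160, 20160, -161280, 1814400],
    [2, -2, 12, -48, 336, -2160, 18720, -161280, 1693440],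
    [0, 12, -48, 324, -2160, 18000, -159840, 1632960],
    [24, -48, 336, -2160, 17856, -158400, 1607040],
    [0, 360, -2160, 18000, -158400, 1598400],
    [720, -2160, 18720, -159840, 1607040],
    [0, 20160, -161280, 1632960],
    [40320, -161280, 1693440],
    [0, 1814400],
    [3628800]]

/-- Lookup in `facetMomentTable`. -/
def tabulatedFacetMoment (i j : ℕ) : ℤ := (facetMomentTable.getD i []).getD j 0

theorem facetMoment_eq_tabulated {i j : ℕ} (h : i + j ≤ 10) :
    facetMoment i j = tabulatedFacetMoment i j := by
  have key : ∀ i < 11, ∀ j < 11 - i, facetMoment i j = tabulatedFacetMoment i j := by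
    decide +kernel
  exact key i (by omega) j (by omega)

theorem detMomentSum_congr {g h : ℕ → ℕ → ℤ} {n : ℕ} (hgh : ∀ i j, i + j ≤ n → g i j = h i j) :
    detMomentSum g n = detMomentSum h n := by
  unfold detMomentSum
  refine sum_congr rfl fun i hi ↦ sum_congr rfl fun j hj ↦ ?_
  congr 1
  refine sum_congr rfl fun a ha ↦ sum_congr rfl fun b hb ↦ sum_congr rfl fun c hc ↦ ?_
  simp only [mem_range] at *
  rw [hgh i j (by omega), hgh (j - b + c) _ (by omega), hgh (b + (n - i - j - c)) _ (by omega)]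

theorem detMomentSum_facetMoment {n : ℕ} (hn : n ≤ 10) :
    detMomentSum facetMoment n = detMomentSum tabulatedFacetMoment n :=
  detMomentSum_congr fun _ _ h ↦ facetMoment_eq_tabulated (h.trans hn)

theorem detMomentSum_zero : detMomentSum facetMoment 0 = 1 := by
  rw [detMomentSum_facetMoment (by norm_num)]; decide +kernel

theorem detMomentSum_two : detMomentSum facetMoment 2 = 36 := by
  rw [detMomentSum_facetMoment (by norm_num)]; decide +kernel

theorem detMomentSum_four : detMomentSum facetMoment 4 = 74304 := by
  rw [detMomentSum_facetMoment (by norm_num)]; decide +kernel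

theorem detMomentSum_six : detMomentSum facetMoment 6 = 1942755840 := by
  rw [detMomentSum_facetMoment (by norm_num)]; decide +kernel

theorem detMomentSum_eight : detMomentSum facetMoment 8 = 323576275599360 := by
  rw [detMomentSum_facetMoment (by norm_num)]; decide +kernel

theorem detMomentSum_ten : detMomentSum facetMoment 10 = 227086913769504768000 := by
  rw [detMomentSum_facetMoment (by norm_num)]; decide +kernel

/-- The coefficients of the even polynomial of degree `10` tangent to `|t|` at `1/10`, `3/10` and
`3/5`. -/
noncomputable def absMajorantCoeff : Fin 6 → ℝ :=
  ![2147 / 49392, 471005 / 74088, -100945375 / 1333584, 4893821875 / 9001692, -76484375 / 45927,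
    3976562500 / 2250423]

theorem abs_le_sum_absMajorantCoeff (t : ℝ) :
    |t| ≤ ∑ k : Fin 6, absMajorantCoeff k * t ^ (2 * (k : ℕ)) := by
  have key (x : ℝ) (hx : 0 ≤ x) : x ≤ ∑ k : Fin 6, absMajorantCoeff k * x ^ (2 * (k : ℕ)) := by
    rw [← sub_nonneg]
    have h : (∑ k : Fin 6, absMajorantCoeff k * x ^ (2 * (k : ℕ))) - x =
        ((x - 1 / 10) * (x - 3 / 10) * (x - 3 / 5)) ^ 2 *
          (33546875 / 250047 + 78218750 / 83349 * x + 6034609375 / 2250423 * x ^ 2 +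
            7953125000 / 2250423 * x ^ 3 + 3976562500 / 2250423 * x ^ 4) := by
      simp [Fin.sum_univ_succ, absMajorantCoeff]
      ring
    rw [h]
    positivity
  simpa only [pow_mul, sq_abs] using key |t| (abs_nonneg t)

open scoped Pointwise in
theorem setIntegral_abs_det₃_lt :
    8 / 3 * ∫ x in centeredTetrahedron, ∫ y in centeredTetrahedron, ∫ z in centeredTetrahedron,
      |det₃ x y z| < 13 / 720 - Real.pi ^ 2 / 15015 := by
  set K := centeredTetrahedron
  have hK : IsCompact K := isCompact_centeredTetrahedron
  have hq : (0 : ℝ) < 19 / 20 := by norm_num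
  have hqK : (19 / 20 : ℝ) • K ⊆ K := by
    rintro _ ⟨x, hx, rfl⟩
    exact (convex_convexHull ℝ _).smul_mem_of_zero_mem zero_mem_centeredTetrahedron hx
      ⟨by norm_num, by norm_num⟩
  set μ := volume.restrict (K \ ((19 / 20 : ℝ) • K)) with hμdef
  have hμ : μ.restrict K = μ := by
    rw [hμdef, Measure.restrict_restrict hK.measurableSet,
      Set.inter_eq_right.2 Set.sdiff_subset]
  have : IsFiniteMeasure μ :=
    ⟨by simpa [hμdef] using (measure_mono Set.sdiff_subset).trans_lt hK.measure_lt_top⟩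
  have h₁ (q : ℝ) (x y z : Fin 3 → ℝ) : det₃ (q • x) y z = q * det₃ x y z := by
    simp [det₃]; ring
  have h₂ (q : ℝ) (x y z : Fin 3 → ℝ) : det₃ x (q • y) z = q * det₃ x y z := by
    simp [det₃]; ring
  have h₃ (q : ℝ) (x y z : Fin 3 → ℝ) : det₃ x y (q • z) = q * det₃ x y z := by
    simp [det₃]; ring
  have habs : HasTripleIntegral (volume.restrict K) (fun x y z ↦ |det₃ x y z|) _ :=
    ⟨by unfold det₃; fun_prop, rfl⟩
  have hleft := habs.diff_smul (n := 1) hK hq hqK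
    (fun x y z ↦ by rw [h₁, abs_mul, abs_of_pos hq, pow_one])
    (fun x y z ↦ by rw [h₂, abs_mul, abs_of_pos hq, pow_one])
    (fun x y z ↦ by rw [h₃, abs_mul, abs_of_pos hq, pow_one])
  have hright := HasTripleIntegral.sum hK hμ (s := univ) fun (k : Fin 6) _ ↦
    ((hasTripleIntegral_det₃_pow (2 * (k : ℕ))).diff_smul (n := 2 * (k : ℕ)) hK hq hqK
      (fun x y z ↦ by rw [h₁, mul_pow]) (fun x y z ↦ by rw [h₂, mul_pow])
      (fun x y z ↦ by rw [h₃, mul_pow])).const_mul (absMajorantCoeff k)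
  have hle := hleft.mono hK hμ hright fun x y z ↦ abs_le_sum_absMajorantCoeff _
  simp [Fin.sum_univ_succ, absMajorantCoeff, detMomentSum_zero, detMomentSum_two,
    detMomentSum_four, detMomentSum_six, detMomentSum_eight, detMomentSum_ten,
    Nat.factorial] at hle
  norm_num at hle
  have hpi : Real.pi ^ 2 < 3.1416 ^ 2 :=
    pow_lt_pow_left₀ Real.pi_lt_d4 Real.pi_pos.le two_ne_zero
  norm_num at hpi
  linarith

end Evaluation

theorem measureReal_convexHull_four (x y z c : Fin 3 → ℝ) :
    volume.real (convexHull ℝ ({x, y, z, c} : Set (Fin 3 → ℝ))) =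
      |det₃ (x - c) (y - c) (z - c)| / 6 := by
  have hrange : ({x, y, z, c} : Set (Fin 3 → ℝ)) = Set.range ![x, y, z, c] := by
    simp [Matrix.range_cons, Set.insert_def, Set.union_def]
  rw [hrange, measureReal_convexHull_range, Matrix.det_fin_three]
  simp [edgeMatrix, det₃, Fin.last, Nat.factorial]
  ring_nf

theorem det₃_mulVec (M : Matrix (Fin 3) (Fin 3) ℝ) (x y z : Fin 3 → ℝ) :
    det₃ (M.mulVec x) (M.mulVec y) (M.mulVec z) = M.det * det₃ x y z := by
  simp [det₃, Matrix.det_fin_three, Matrix.mulVec, dotProduct, Fin.sum_univ_three]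
  ring

theorem image_centeredTetrahedron (v : Fin 4 → Fin 3 → ℝ) {c : Fin 3 → ℝ}
    (hc : c = (3 : ℝ)⁻¹ • (v 0 + v 1 + v 2)) :
    (fun x ↦ c + (Matrix.of ![v 0 - c, v 1 - c, v 3 - c]).transpose.mulVec x) ''
      centeredTetrahedron = convexHull ℝ (Set.range v) := by
  set M := (Matrix.of ![v 0 - c, v 1 - c, v 3 - c]).transpose with hM
  let φ : (Fin 3 → ℝ) →ᵃ[ℝ] (Fin 3 → ℝ) :=
    AffineMap.const ℝ (Fin 3 → ℝ) c + (Matrix.toLin' M).toAffineMap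
  have hφ : ∀ x, φ x = c + M.mulVec x := fun x ↦ rfl
  have hv : φ ∘ centeredVertex = v := by
    ext i l
    fin_cases i <;>
      simp [hφ, hM, centeredVertex, Matrix.mulVec, dotProduct, Fin.sum_univ_three, hc]
    ring
  change φ '' convexHull ℝ (Set.range centeredVertex) = _
  rw [φ.image_convexHull, ← Set.range_comp, hv]

theorem expected_volume_with_centroid_lt (v : Fin 4 → (Fin 3 → ℝ))
    (hv : AffineIndependent ℝ v) (T : Set (Fin 3 → ℝ))
    (hT : T = convexHull ℝ (Set.range v)) (hvol : volume T = 1)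
    (c : Fin 3 → ℝ) (hc : c = (3:ℝ)⁻¹ • (v 0 + v 1 + v 2)) :
    (∫ x₁ in T, ∫ x₂ in T, ∫ x₃ in T,
        (volume (convexHull ℝ ({x₁, x₂, x₃, c} : Set (Fin 3 → ℝ)))).toReal)
      < 13 / 720 - Real.pi ^ 2 / 15015 := by
  have himage := image_centeredTetrahedron v hc
  set M := (Matrix.of ![v 0 - c, v 1 - c, v 3 - c]).transpose
  have hdet : |M.det| = 2 := by
    have h : volume.real T = 1 := by simp [Measure.real, hvol]
    rw [hT, ← himage, measureReal_image_affine, measureReal_centeredTetrahedron] at h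
    linarith
  have hM : M.det ≠ 0 := by
    rw [← abs_pos, hdet]; norm_num
  have hintegral (f : (Fin 3 → ℝ) → ℝ) :
      ∫ x in T, f x = 2 * ∫ x in centeredTetrahedron, f (c + M.mulVec x) := by
    rw [hT, ← himage, setIntegral_image_affine c hM isCompact_centeredTetrahedron.measurableSet,
      hdet]
  have hvolume (x y z : Fin 3 → ℝ) :
      (volume (convexHull ℝ ({c + M.mulVec x, c + M.mulVec y, c + M.mulVec z, c} :
        Set (Fin 3 → ℝ)))).toReal = 1 / 3 * |det₃ x y z| := by
    have := measureReal_convexHull_four (c + M.mulVec x) (c + M.mulVec y) (c + M.mulVec z) c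
    rw [add_sub_cancel_left, add_sub_cancel_left, add_sub_cancel_left, det₃_mulVec, abs_mul,
      hdet] at this
    rw [← Measure.real, this]
    ring
  simp only [hintegral, hvolume, integral_const_mul]
  linarith [setIntegral_abs_det₃_lt]
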